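/- arXiv:2504.19229 — 4 statements merged into one kernel-verified Lean document; each statement's English description precedes it below -/
import Mathlib

section
/- Let d ≥ 1, let F : ℝ^d → ℝ^d be μ-strongly monotone for some μ > 0 and l-Lipschitz for some l > 0, and let x* ∈ ℝ^d be the unique point with F(x*) = 0. Fix k₁ with 0 < k₁ < μ/l². Then for every differentiable pair (x, v) : [0,∞) → ℝ^d × ℝ^d satisfying x'(t) = v(t) and v'(t) = -k₁ F(x(t)) - v(t) for all t ≥ 0, the function V(t) = ½‖x(t) + v(t) - x*‖² + ½‖v(t)‖² satisfies V(t) ≤ V(0)·exp(-(2λ/3)·t) for all t ≥ 0, where λ > 0 is the smallest eigenvalue of the 2×2 symmetric matrix [[k₁μ, k₁l],[k₁l, 1]]. In particular, ‖x(t) - x*‖ and ‖v(t)‖ converge to 0 exponentially fast as t → ∞. -/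
open scoped RealInnerProductSpace

/-- The smallest eigenvalue of a real symmetric `2 × 2` matrix bounds its quadratic form below. -/
theorem iInf_eigenvalues_mul_le_quadratic_form {p q r : ℝ}
    (hB : (Matrix.of ![![p, q], ![q, r]]).IsHermitian) (a b : ℝ) :
    (⨅ i, hB.eigenvalues i) * (a ^ 2 + b ^ 2) ≤ p * a ^ 2 - 2 * q * a * b + r * b ^ 2 := by
  have hdet := hB.det_eq_prod_eigenvalues
  have htr := hB.trace_eq_sum_eigenvalues
  simp only [Matrix.det_fin_two, Matrix.trace_fin_two, Fin.prod_univ_two, Fin.sum_univ_two,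
    Matrix.of_apply, Matrix.cons_val_zero, Matrix.cons_val_one, RCLike.ofReal_real_eq_id, id]
    at hdet htr
  have h0 := ciInf_le (Set.finite_range hB.eigenvalues).bddBelow 0
  have h1 := ciInf_le (Set.finite_range hB.eigenvalues).bddBelow 1
  obtain ⟨i, hi⟩ := exists_eq_ciInf_of_finite (f := hB.eigenvalues)
  generalize (⨅ i, hB.eigenvalues i) = m at *
  have hchar : (p - m) * (r - m) = q ^ 2 := by
    fin_cases i <;> simp only [Fin.zero_eta, Fin.mk_one] at hi <;> subst hi <;>
      linear_combination hdet - hB.eigenvalues _ * htr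
  have hsum : 0 ≤ (p - m) + (r - m) := by linarith
  have hsq : 0 ≤ ((p - m) + (r - m)) *
      ((p - m) * a ^ 2 - 2 * q * a * b + (r - m) * b ^ 2) := by
    have : ((p - m) + (r - m)) * ((p - m) * a ^ 2 - 2 * q * a * b + (r - m) * b ^ 2) =
        ((p - m) * a - q * b) ^ 2 + (q * a - (r - m) * b) ^ 2 := by
      linear_combination (a ^ 2 + b ^ 2) * hchar
    rw [this]
    positivity
  rcases hsum.eq_or_lt with h | h
  · have hp : p - m = 0 := by nlinarith [sq_nonneg q, sq_nonneg (p - m)]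
    have hr : r - m = 0 := by linarith
    have hq : q = 0 := by
      rw [hp, zero_mul] at hchar
      exact pow_eq_zero_iff two_ne_zero |>.mp hchar.symm
    rw [sub_eq_zero] at hp hr
    subst hq hp
    rw [hr]
    linarith
  · linarith [nonneg_of_mul_nonneg_right hsq h]

/-- Grönwall's inequality for a scalar function with `f' ≤ -c f` on `[0, ∞)`. -/
theorem le_mul_exp_of_hasDerivAt_le_neg_mul {f f' : ℝ → ℝ} {c : ℝ}
    (hf : ∀ t, 0 ≤ t → HasDerivAt f (f' t) t) (hle : ∀ t, 0 ≤ t → f' t ≤ -c * f t)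
    {t : ℝ} (ht : 0 ≤ t) : f t ≤ f 0 * Real.exp (-c * t) := by
  have hderiv : ∀ s, 0 ≤ s → HasDerivAt (fun s => f s * Real.exp (c * s))
      (f' s * Real.exp (c * s) + f s * (Real.exp (c * s) * (c * 1))) s := fun s hs =>
    (hf s hs).mul ((hasDerivAt_id s).const_mul c).exp
  have hanti : AntitoneOn (fun s => f s * Real.exp (c * s)) (Set.Ici 0) := by
    refine antitoneOn_of_hasDerivWithinAt_nonpos (convex_Ici 0)
      (fun s hs => (hderiv s hs).continuousAt.continuousWithinAt)
      (fun s hs => (hderiv s (interior_subset hs)).hasDerivWithinAt) fun s hs => ?_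
    nlinarith [hle s (interior_subset hs), Real.exp_pos (c * s)]
  have h := hanti Set.self_mem_Ici ht ht
  simp only [mul_zero, Real.exp_zero, mul_one] at h
  calc f t = f t * Real.exp (c * t) * Real.exp (-c * t) := by
        rw [mul_assoc, ← Real.exp_add]; simp
    _ ≤ f 0 * Real.exp (-c * t) := by gcongr

/-- Theorem 1 of the paper: exponential stability of the reduced second-order
gradient-play system `ẋ = v`, `v̇ = -k₁ F(x) - v` towards the Nash equilibrium
`x*` (the unique zero of the `μ`-strongly monotone, `l`-Lipschitz pseudo-gradient
`F`), with Lyapunov function `V(t) = ½‖x + v - x*‖² + ½‖v‖²` decaying at rate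
`2λ/3`, where `λ > 0` is the smallest eigenvalue of `[[k₁μ, k₁l],[k₁l, 1]]`;
in particular `‖x(t) - x*‖` and `‖v(t)‖` converge to `0` exponentially fast. -/
theorem stmt_0 (d : ℕ) (hd : 1 ≤ d) (μ l k₁ : ℝ) (hμ : 0 < μ) (hl : 0 < l)
    (F : EuclideanSpace ℝ (Fin d) → EuclideanSpace ℝ (Fin d))
    (hmono : ∀ x₁ x₂ : EuclideanSpace ℝ (Fin d),
      μ * ‖x₁ - x₂‖ ^ 2 ≤ ⟪x₁ - x₂, F x₁ - F x₂⟫)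
    (hlip : ∀ x₁ x₂ : EuclideanSpace ℝ (Fin d), ‖F x₁ - F x₂‖ ≤ l * ‖x₁ - x₂‖)
    (xstar : EuclideanSpace ℝ (Fin d)) (hxstar : F xstar = 0)
    (hk₁ : 0 < k₁) (hk₁' : k₁ < μ / l ^ 2)
    (hB : (Matrix.of ![![k₁ * μ, k₁ * l], ![k₁ * l, 1]]).IsHermitian)
    (lam : ℝ) (hlam : lam = ⨅ i, hB.eigenvalues i) (hlampos : 0 < lam)
    (x v : ℝ → EuclideanSpace ℝ (Fin d))
    (hx : ∀ t : ℝ, 0 ≤ t → HasDerivAt x (v t) t)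
    (hv : ∀ t : ℝ, 0 ≤ t → HasDerivAt v (-(k₁ • F (x t)) - v t) t)
    (V : ℝ → ℝ)
    (hV : ∀ t : ℝ, V t = (1 / 2) * ‖x t + v t - xstar‖ ^ 2 + (1 / 2) * ‖v t‖ ^ 2) :
    (∀ t : ℝ, 0 ≤ t → V t ≤ V 0 * Real.exp (-(2 * lam / 3) * t)) ∧
      (∃ C c : ℝ, 0 < C ∧ 0 < c ∧ ∀ t : ℝ, 0 ≤ t →
        ‖x t - xstar‖ ≤ C * Real.exp (-c * t) ∧ ‖v t‖ ≤ C * Real.exp (-c * t)) := by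
  have hVderiv : ∀ t, 0 ≤ t → HasDerivAt V
      (-(k₁ * ⟪x t - xstar, F (x t)⟫) - 2 * (k₁ * ⟪v t, F (x t)⟫) - ‖v t‖ ^ 2) t := by
    intro t ht
    have hw := (((hx t ht).add (hv t ht)).sub_const xstar).norm_sq
    have h := (hw.const_mul (1 / 2)).add ((hv t ht).norm_sq.const_mul (1 / 2))
    refine (h.congr_deriv ?_).congr_of_eventuallyEq (Filter.Eventually.of_forall hV)
    have h₁ : v t + (-(k₁ • F (x t)) - v t) = -(k₁ • F (x t)) := by abel
    have h₂ : x t + v t - xstar = (x t - xstar) + v t := by abel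
    simp only [Pi.add_apply, h₁, h₂, inner_add_left, inner_sub_right, inner_neg_right,
      inner_smul_right, real_inner_self_eq_norm_sq]
    ring
  have hdecay : ∀ t, 0 ≤ t → V t ≤ V 0 * Real.exp (-(2 * lam / 3) * t) := by
    refine fun t ht => le_mul_exp_of_hasDerivAt_le_neg_mul hVderiv (fun s _ => ?_) ht
    have hF₁ : μ * ‖x s - xstar‖ ^ 2 ≤ ⟪x s - xstar, F (x s)⟫ := by
      simpa [hxstar] using hmono (x s) xstar
    have hF₂ : -(‖v s‖ * (l * ‖x s - xstar‖)) ≤ ⟪v s, F (x s)⟫ := by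
      have hF : ‖F (x s)‖ ≤ l * ‖x s - xstar‖ := by simpa [hxstar] using hlip (x s) xstar
      have := mul_le_mul_of_nonneg_left hF (norm_nonneg (v s))
      linarith [neg_le_of_abs_le (abs_real_inner_le_norm (v s) (F (x s)))]
    have hquad := iInf_eigenvalues_mul_le_quadratic_form hB ‖x s - xstar‖ ‖v s‖
    rw [← hlam] at hquad
    have hVle : V s ≤ 3 / 2 * (‖x s - xstar‖ ^ 2 + ‖v s‖ ^ 2) := by
      have hw : ‖x s + v s - xstar‖ ≤ ‖x s - xstar‖ + ‖v s‖ := by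
        rw [add_sub_right_comm]
        exact norm_add_le _ _
      have hw₂ := pow_le_pow_left₀ (norm_nonneg _) hw 2
      rw [hV]
      nlinarith [sq_nonneg (2 * ‖x s - xstar‖ - ‖v s‖)]
    have := mul_le_mul_of_nonneg_left hVle hlampos.le
    have := mul_le_mul_of_nonneg_left hF₁ hk₁.le
    have := mul_le_mul_of_nonneg_left hF₂ hk₁.le
    linarith
  refine ⟨hdecay, 2 * √(2 * V 0) + 1, lam / 3, by positivity, by positivity, fun t ht => ?_⟩
  have hV0 : 0 ≤ V 0 := by rw [hV]; positivity
  have hbound : 2 * V t ≤ (√(2 * V 0) * Real.exp (-(lam / 3) * t)) ^ 2 := by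
    rw [mul_pow, Real.sq_sqrt (by positivity), ← Real.exp_nat_mul]
    have : ((2 : ℕ) : ℝ) * (-(lam / 3) * t) = -(2 * lam / 3) * t := by push_cast; ring
    rw [this]
    linarith [hdecay t ht]
  have hVt := hV t
  have hv_le : ‖v t‖ ≤ √(2 * V 0) * Real.exp (-(lam / 3) * t) :=
    pow_le_pow_iff_left₀ (norm_nonneg _) (by positivity) two_ne_zero |>.mp
      (by nlinarith [sq_nonneg ‖x t + v t - xstar‖])
  have hw_le : ‖x t + v t - xstar‖ ≤ √(2 * V 0) * Real.exp (-(lam / 3) * t) :=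
    pow_le_pow_iff_left₀ (norm_nonneg _) (by positivity) two_ne_zero |>.mp
      (by nlinarith [sq_nonneg ‖v t‖])
  have hx_le : ‖x t - xstar‖ ≤ ‖x t + v t - xstar‖ + ‖v t‖ := by
    have : x t - xstar = (x t + v t - xstar) - v t := by abel
    rw [this]
    exact norm_sub_le _ _
  have hnn : 0 ≤ √(2 * V 0) * Real.exp (-(lam / 3) * t) := by positivity
  have hE := Real.exp_pos (-(lam / 3) * t)
  constructor <;> linarith
end

section
/- Let d ≥ 1, let F : ℝ^d → ℝ^d be μ-strongly monotone for some μ > 0 and l-Lipschitz for some l > 0, let x* satisfy F(x*) = 0, and let 0 < k₁ < μ/l². Let λ > 0 denote the smallest eigenvalue of the 2×2 symmetric matrix [[k₁μ, k₁l],[k₁l, 1]]. Then for all x, v ∈ ℝ^d: -k₁⟪x - x*, F(x) - F(x*)⟫ - ‖v‖² - 2k₁⟪v, F(x) - F(x*)⟫ ≤ -(2λ/3)·(½‖x + v - x*‖² + ½‖v‖²). -/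
open scoped RealInnerProductSpace

/-- A real symmetric `2 × 2` matrix is bounded below, as a quadratic form, by any lower bound of
its eigenvalues. -/
theorem Matrix.IsHermitian.mul_sq_add_sq_le_of_le_eigenvalues {p q r c : ℝ}
    (hB : (Matrix.of ![![p, r], ![r, q]]).IsHermitian) (hc : ∀ i, c ≤ hB.eigenvalues i)
    (a b : ℝ) : c * (a ^ 2 + b ^ 2) ≤ p * a ^ 2 + 2 * r * a * b + q * b ^ 2 := by
  have htr := hB.trace_eq_sum_eigenvalues
  have hdet := hB.det_eq_prod_eigenvalues
  simp only [Matrix.trace_fin_two, Matrix.det_fin_two, Fin.sum_univ_two, Fin.prod_univ_two,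
    Matrix.of_apply, Matrix.cons_val_zero, Matrix.cons_val_one, RCLike.ofReal_real_eq_id,
    id_eq] at htr hdet
  have h0 := hc 0
  have h1 := hc 1
  have hsum : 0 ≤ (p - c) + (q - c) := by linarith
  have hprod : r ^ 2 ≤ (p - c) * (q - c) := by
    have := mul_nonneg (sub_nonneg.2 h0) (sub_nonneg.2 h1)
    linear_combination this - hdet + c * htr
  have hmul : 0 ≤ ((p - c) + (q - c)) *
      ((p - c) * a ^ 2 + 2 * r * a * b + (q - c) * b ^ 2) := by
    nlinarith [sq_nonneg ((p - c) * a + r * b), sq_nonneg (r * a + (q - c) * b),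
      mul_nonneg (sub_nonneg.2 hprod) (add_nonneg (sq_nonneg a) (sq_nonneg b))]
  rcases hsum.eq_or_lt with hzero | hpos
  · have hq : q - c = -(p - c) := by linarith
    rw [hq] at hprod
    have hp : p - c = 0 := by nlinarith [sq_nonneg r]
    have hr : r = 0 := by nlinarith [sq_nonneg r]
    have hp' : p = c := by linarith
    have hq' : q = c := by linarith
    simp only [hp', hq', hr]
    linarith
  · linarith [nonneg_of_mul_nonneg_right hmul hpos]

/-- Key Lyapunov-derivative inequality from the proof of Theorem 1:
for a `μ`-strongly monotone, `l`-Lipschitz map `F : ℝ^d → ℝ^d` with zero `x*`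
and `0 < k₁ < μ/l²`, letting `λ` be the smallest eigenvalue of the symmetric
matrix `[[k₁μ, k₁l],[k₁l, 1]]`, for all `x, v`:
`-k₁⟪x - x*, F x - F x*⟫ - ‖v‖² - 2k₁⟪v, F x - F x*⟫ ≤ -(2λ/3)(½‖x + v - x*‖² + ½‖v‖²)`. -/
theorem stmt_1 (d : ℕ) (hd : 1 ≤ d) (μ l k₁ : ℝ) (hμ : 0 < μ) (hl : 0 < l)
    (F : EuclideanSpace ℝ (Fin d) → EuclideanSpace ℝ (Fin d))
    (hmono : ∀ x₁ x₂ : EuclideanSpace ℝ (Fin d),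
      μ * ‖x₁ - x₂‖ ^ 2 ≤ ⟪x₁ - x₂, F x₁ - F x₂⟫)
    (hlip : ∀ x₁ x₂ : EuclideanSpace ℝ (Fin d), ‖F x₁ - F x₂‖ ≤ l * ‖x₁ - x₂‖)
    (xstar : EuclideanSpace ℝ (Fin d)) (hxstar : F xstar = 0)
    (hk₁ : 0 < k₁) (hk₁' : k₁ < μ / l ^ 2)
    (hB : (Matrix.of ![![k₁ * μ, k₁ * l], ![k₁ * l, 1]]).IsHermitian)
    (lam : ℝ) (hlam : lam = ⨅ i, hB.eigenvalues i) (hlampos : 0 < lam) :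
    ∀ x v : EuclideanSpace ℝ (Fin d),
      -(k₁ * ⟪x - xstar, F x - F xstar⟫) - ‖v‖ ^ 2
          - 2 * k₁ * ⟪v, F x - F xstar⟫
        ≤ -(2 * lam / 3) * ((1 / 2) * ‖x + v - xstar‖ ^ 2 + (1 / 2) * ‖v‖ ^ 2) := by
  intro x v
  have hle : ∀ i, lam ≤ hB.eigenvalues i := fun i =>
    hlam ▸ ciInf_le (Set.finite_range _).bddBelow i
  have hquad := hB.mul_sq_add_sq_le_of_le_eigenvalues hle ‖x - xstar‖ (-‖v‖)
  have hinner : -⟪v, F x - F xstar⟫ ≤ ‖v‖ * (l * ‖x - xstar‖) :=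
    (neg_le_abs _).trans <| (abs_real_inner_le_norm _ _).trans <|
      mul_le_mul_of_nonneg_left (hlip x xstar) (norm_nonneg v)
  have hcross := mul_le_mul_of_nonneg_left hinner hk₁.le
  have hdiag := mul_le_mul_of_nonneg_left (hmono x xstar) hk₁.le
  have htri : ‖x + v - xstar‖ ≤ ‖x - xstar‖ + ‖v‖ := by
    rw [add_sub_right_comm]
    exact norm_add_le _ _
  have hV : (1 / 2) * ‖x + v - xstar‖ ^ 2 + (1 / 2) * ‖v‖ ^ 2
      ≤ 3 / 2 * (‖x - xstar‖ ^ 2 + ‖v‖ ^ 2) := by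
    nlinarith [pow_le_pow_left₀ (norm_nonneg _) htri 2,
      sq_nonneg (‖x - xstar‖ - ‖v‖)]
  have hlamV := mul_le_mul_of_nonneg_left hV hlampos.le
  linarith
end

section
/- Let N ≥ 2, n ≥ 1, and let A ∈ ℝ^{N×N} be symmetric with nonnegative entries and zero diagonal such that its Laplacian L = diag(Σⱼ A_{1j}, …, Σⱼ A_{Nj}) - A satisfies: xᵀLx = 0 implies x = c·𝟏_N for some scalar c. Let 𝔐 ∈ ℝ^{N²×N²} be the diagonal matrix whose diagonal entries are A_{11}, A_{12}, …, A_{1N}, A_{21}, …, A_{NN} in this order. Then the matrix L ⊗ I_N + 𝔐 is symmetric positive definite (and hence so is (L ⊗ I_N + 𝔐) ⊗ I_n). -/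
open Matrix
open scoped Kronecker

/-- The quadratic form of a weighted Laplacian as a sum of squared differences. -/
lemma two_mul_dotProduct_laplacian_mulVec {ι : Type*} [Fintype ι] [DecidableEq ι]
    {A : Matrix ι ι ℝ} (hA : A.IsSymm) (x : ι → ℝ) :
    2 * (x ⬝ᵥ (Matrix.diagonal (fun i => ∑ j, A i j) - A).mulVec x) =
      ∑ i, ∑ j, A i j * (x i - x j) ^ 2 := by
  have hswap : ∑ i, ∑ j, A i j * x j ^ 2 = ∑ i, ∑ j, A i j * x i ^ 2 := by
    rw [Finset.sum_comm]
    simp only [fun i j => hA.apply i j]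
  have hform : x ⬝ᵥ (Matrix.diagonal (fun i => ∑ j, A i j) - A).mulVec x =
      ∑ i, ∑ j, A i j * x i ^ 2 - ∑ i, ∑ j, A i j * (x i * x j) := by
    rw [sub_mulVec, dotProduct_sub]
    simp only [dotProduct, mulVec_diagonal]
    simp only [mulVec, dotProduct, Finset.mul_sum, Finset.sum_mul]
    congr 1 <;> exact Finset.sum_congr rfl fun i _ => Finset.sum_congr rfl fun j _ => by ring
  have hexpand : ∑ i, ∑ j, A i j * (x i - x j) ^ 2 =
      ∑ i, ∑ j, A i j * x i ^ 2 + ∑ i, ∑ j, A i j * x j ^ 2 -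
        2 * ∑ i, ∑ j, A i j * (x i * x j) := by
    simp only [Finset.mul_sum, ← Finset.sum_add_distrib, ← Finset.sum_sub_distrib]
    exact Finset.sum_congr rfl fun i _ => Finset.sum_congr rfl fun j _ => by ring
  rw [hexpand, hswap, hform]
  ring

lemma dotProduct_laplacian_mulVec_nonneg {ι : Type*} [Fintype ι] [DecidableEq ι]
    {A : Matrix ι ι ℝ} (hA : A.IsSymm) (hnonneg : ∀ i j, 0 ≤ A i j) (x : ι → ℝ) :
    0 ≤ x ⬝ᵥ (Matrix.diagonal (fun i => ∑ j, A i j) - A).mulVec x := by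
  have h : 0 ≤ ∑ i, ∑ j, A i j * (x i - x j) ^ 2 :=
    Finset.sum_nonneg fun i _ => Finset.sum_nonneg fun j _ =>
      mul_nonneg (hnonneg i j) (sq_nonneg _)
  linarith [two_mul_dotProduct_laplacian_mulVec hA x]

/-- If the kernel of the Laplacian form consists of constants, no vertex is isolated. -/
lemma exists_weight_ne_zero {ι : Type*} [Fintype ι] [DecidableEq ι] [Nontrivial ι]
    {A : Matrix ι ι ℝ} (hA : A.IsSymm)
    (hconn : ∀ x : ι → ℝ, x ⬝ᵥ (Matrix.diagonal (fun i => ∑ j, A i j) - A).mulVec x = 0 →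
      ∃ c : ℝ, x = fun _ => c) (k : ι) :
    ∃ i, A i k ≠ 0 := by
  by_contra! h
  have h' : ∀ j, A k j = 0 := fun j => by rw [← hA.apply, h]
  obtain ⟨c, hc⟩ := hconn (Pi.single k 1) (by simp [h, h'])
  obtain ⟨j, hj⟩ := exists_ne k
  have h1 := congrFun hc k
  have h2 := congrFun hc j
  simp [hj] at h1 h2
  linarith

/-- The quadratic form of `L ⊗ I + diag(w)` splits along the columns of the vector. -/
lemma dotProduct_kronecker_one_add_diagonal_mulVec {ι κ : Type*} [Fintype ι] [Fintype κ]
    [DecidableEq ι] [DecidableEq κ] (L : Matrix ι ι ℝ) (w v : ι × κ → ℝ) :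
    v ⬝ᵥ (L ⊗ₖ (1 : Matrix κ κ ℝ) + Matrix.diagonal w).mulVec v =
      ∑ k, ((fun i => v (i, k)) ⬝ᵥ L.mulVec (fun i => v (i, k)) +
        ∑ i, w (i, k) * v (i, k) ^ 2) := by
  rw [add_mulVec, dotProduct_add, Finset.sum_add_distrib]
  congr 1
  · simp only [dotProduct, mulVec, Fintype.sum_prod_type_right, kroneckerMap_apply, one_apply]
    refine Finset.sum_congr rfl fun k _ => Finset.sum_congr rfl fun i _ => ?_
    congr 1
    rw [Finset.sum_comm]
    simp
  · simp only [dotProduct, mulVec_diagonal, Fintype.sum_prod_type_right]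
    exact Finset.sum_congr rfl fun k _ => Finset.sum_congr rfl fun i _ => by ring

/-- For a symmetric nonnegative weight matrix `A` with zero diagonal whose
Laplacian `L = diag(row sums) - A` vanishes (as a quadratic form) only on
constant vectors (connectedness), the matrix `L ⊗ I_N + 𝔐` is symmetric positive
definite, where `𝔐` is the diagonal matrix with entries `A₁₁, A₁₂, …, A_{NN}`;
hence so is `(L ⊗ I_N + 𝔐) ⊗ I_n`. -/
theorem stmt_4 (N n : ℕ) (hN : 2 ≤ N) (hn : 1 ≤ n)
    (A : Matrix (Fin N) (Fin N) ℝ) (hsymm : A.IsSymm)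
    (hnonneg : ∀ i j, 0 ≤ A i j) (hdiag : ∀ i, A i i = 0)
    (L : Matrix (Fin N) (Fin N) ℝ)
    (hL : L = Matrix.diagonal (fun i => ∑ j, A i j) - A)
    (hconn : ∀ x : Fin N → ℝ, x ⬝ᵥ L.mulVec x = 0 → ∃ c : ℝ, x = fun _ => c)
    (𝔐 : Matrix (Fin N × Fin N) (Fin N × Fin N) ℝ)
    (h𝔐 : 𝔐 = Matrix.diagonal (fun p : Fin N × Fin N => A p.1 p.2)) :
    (L ⊗ₖ (1 : Matrix (Fin N) (Fin N) ℝ) + 𝔐).IsHermitian ∧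
      (L ⊗ₖ (1 : Matrix (Fin N) (Fin N) ℝ) + 𝔐).PosDef ∧
      ((L ⊗ₖ (1 : Matrix (Fin N) (Fin N) ℝ) + 𝔐) ⊗ₖ
          (1 : Matrix (Fin n) (Fin n) ℝ)).PosDef := by
  subst hL h𝔐
  have : Nontrivial (Fin N) := Fin.nontrivial_iff_two_le.2 hN
  have hpos : ((Matrix.diagonal (fun i => ∑ j, A i j) - A) ⊗ₖ (1 : Matrix (Fin N) (Fin N) ℝ) +
      Matrix.diagonal (fun p : Fin N × Fin N => A p.1 p.2)).PosDef := by
    refine .of_dotProduct_mulVec_pos ?_ fun v hv => ?_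
    · have hLap : (Matrix.diagonal (fun i => ∑ j, A i j) - A).IsHermitian :=
        (isHermitian_diagonal _).sub (by simpa [IsHermitian, IsSymm] using hsymm)
      refine IsHermitian.add ?_ (isHermitian_diagonal _)
      rw [IsHermitian, conjTranspose_kronecker, hLap.eq, conjTranspose_one]
    rw [star_trivial, dotProduct_kronecker_one_add_diagonal_mulVec]
    have hquad := fun k => dotProduct_laplacian_mulVec_nonneg hsymm hnonneg (fun i => v (i, k))
    have hterm : ∀ i k, 0 ≤ A i k * v (i, k) ^ 2 := fun i k =>
      mul_nonneg (hnonneg i k) (sq_nonneg _)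
    have hweight : ∀ k, 0 ≤ ∑ i, A i k * v (i, k) ^ 2 := fun k =>
      Finset.sum_nonneg fun i _ => hterm i k
    have hcol := fun k => add_nonneg (hquad k) (hweight k)
    refine lt_of_le_of_ne (Finset.sum_nonneg fun k _ => hcol k) fun h0 => hv ?_
    rw [eq_comm, Finset.sum_eq_zero_iff_of_nonneg fun k _ => hcol k] at h0
    ext ⟨j, k⟩
    obtain ⟨hq, hw⟩ := (add_eq_zero_iff_of_nonneg (hquad k) (hweight k)).1
      (h0 k (Finset.mem_univ k))
    obtain ⟨c, hc⟩ := hconn _ hq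
    obtain ⟨i, hi⟩ := exists_weight_ne_zero hsymm hconn k
    have hik := (Finset.sum_eq_zero_iff_of_nonneg fun i _ => hterm i k).1 hw i
      (Finset.mem_univ i)
    have hvi : v (i, k) = 0 := by simpa [hi] using hik
    exact ((congrFun hc j).trans (congrFun hc i).symm).trans hvi
  exact ⟨hpos.isHermitian, hpos, hpos.kronecker .one⟩
end

section
/- Let n, m ≥ 1, let Z ∈ ℝ^{n×n} be symmetric positive definite, let W₁, W₂ ∈ ℝ^{n×m}, and suppose there exists a matrix S ∈ ℝ^{n×n} such that the 2n×2n block matrix [[Z, S],[Sᵀ, Z]] is positive definite. Then for every χ ∈ (0,1) and every x ∈ ℝ^m: (1/χ)·xᵀW₁ᵀZW₁x + (1/(1-χ))·xᵀW₂ᵀZW₂x ≥ xᵀ(W₁ᵀZW₁ + W₁ᵀSW₂ + W₂ᵀSᵀW₁ + W₂ᵀZW₂)x. -/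
open Matrix

theorem Matrix.dotProduct_transpose_mul_mul_mulVec {R m n p q : Type*} [CommSemiring R]
    [Fintype m] [Fintype n] [Fintype p] [Fintype q] (A : Matrix n m R) (M : Matrix n p R)
    (B : Matrix p q R) (x : m → R) (y : q → R) :
    x ⬝ᵥ (Aᵀ * M * B) *ᵥ y = (A *ᵥ x) ⬝ᵥ M *ᵥ (B *ᵥ y) := by
  rw [Matrix.mul_assoc, ← mulVec_mulVec, dotProduct_mulVec, vecMul_transpose, mulVec_mulVec]

theorem Matrix.sumElim_dotProduct_fromBlocks_mulVec_sumElim {R m n : Type*} [CommSemiring R]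
    [Fintype m] [Fintype n] (A : Matrix m m R) (B : Matrix m n R) (C : Matrix n m R)
    (D : Matrix n n R) (u : m → R) (v : n → R) :
    Sum.elim u v ⬝ᵥ fromBlocks A B C D *ᵥ Sum.elim u v =
      u ⬝ᵥ A *ᵥ u + u ⬝ᵥ B *ᵥ v + (v ⬝ᵥ C *ᵥ u + v ⬝ᵥ D *ᵥ v) := by
  simp [fromBlocks_mulVec, sumElim_dotProduct_sumElim, dotProduct_add]

/-- Reciprocally convex combination lemma (Lemma 3 of the paper): if `Z` is
symmetric positive definite and there is `S` with `[[Z, S],[Sᵀ, Z]]` positive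
definite, then for all `χ ∈ (0,1)` and all `x`:
`(1/χ)xᵀW₁ᵀZW₁x + (1/(1-χ))xᵀW₂ᵀZW₂x ≥ xᵀ(W₁ᵀZW₁ + W₁ᵀSW₂ + W₂ᵀSᵀW₁ + W₂ᵀZW₂)x`. -/
theorem stmt_9 (n m : ℕ) (hn : 1 ≤ n) (hm : 1 ≤ m)
    (Z : Matrix (Fin n) (Fin n) ℝ) (hZ : Z.PosDef)
    (W₁ W₂ : Matrix (Fin n) (Fin m) ℝ)
    (S : Matrix (Fin n) (Fin n) ℝ)
    (hblock : (Matrix.fromBlocks Z S Sᵀ Z).PosDef) :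
    ∀ χ : ℝ, 0 < χ → χ < 1 → ∀ x : Fin m → ℝ,
      x ⬝ᵥ (W₁ᵀ * Z * W₁ + W₁ᵀ * S * W₂ + W₂ᵀ * Sᵀ * W₁ + W₂ᵀ * Z * W₂).mulVec x ≤
        (1 / χ) * (x ⬝ᵥ (W₁ᵀ * Z * W₁).mulVec x) +
          (1 / (1 - χ)) * (x ⬝ᵥ (W₂ᵀ * Z * W₂).mulVec x) := by
  intro χ hχ0 hχ1 x
  simp only [add_mulVec, dotProduct_add, dotProduct_transpose_mul_mul_mulVec]
  set u := W₁ *ᵥ x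
  set v := W₂ *ᵥ x
  have hblock_nonneg := hblock.posSemidef.dotProduct_mulVec_nonneg
    (Sum.elim ((1 - χ) • u) (-χ • v))
  rw [star_trivial, sumElim_dotProduct_fromBlocks_mulVec_sumElim] at hblock_nonneg
  simp only [mulVec_smul, smul_dotProduct, dotProduct_smul, smul_eq_mul] at hblock_nonneg
  have hχ1' : 0 < 1 - χ := sub_pos.mpr hχ1
  rw [div_mul_eq_mul_div, div_mul_eq_mul_div, div_add_div _ _ hχ0.ne' hχ1'.ne',
    le_div_iff₀ (mul_pos hχ0 hχ1')]
  linarith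
end
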